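/- arXiv:2602.23343 — 3 statements merged into one kernel-verified Lean document; each statement's English description precedes it below -/
import Mathlib

section
/- A domino tiling of the rectangle (n,n) admits more than one increasing labeling (i.e., there exist at least two distinct domino tableaux of shape (n,n) with that underlying tiling) if and only if the tiling contains a k-stack with k ≥ 2. -/
open scoped Classical

/-- Two cells of the plane (given as (row, column) pairs) are adjacent if they share an edge. -/
def DominoAdj (c d : ℕ × ℕ) : Prop :=
  (c.1 = d.1 ∧ (c.2 + 1 = d.2 ∨ d.2 + 1 = c.2)) ∨
  (c.2 = d.2 ∧ (c.1 + 1 = d.1 ∨ d.1 + 1 = c.1))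

/-- A domino tableau of the shape whose `i`-th row (0-indexed, English notation) has
`rowLen i` cells, with `N` dominoes labeled `1, …, N`.  The label function assigns to each
cell of the diagram the label of the domino covering it (and `0` outside the diagram);
each label in `[1, N]` occupies exactly two edge-adjacent cells (a vertical `2×1` or
horizontal `1×2` domino), and the domino labels strictly increase along rows (left to
right) and down columns: cell labels are weakly increasing, with equal labels in a row or
column only for the two cells of a single domino. -/
structure DominoTableau (rowLen : ℕ → ℕ) (N : ℕ) where
  label : ℕ × ℕ → ℕ
  support : ∀ c : ℕ × ℕ, label c ≠ 0 ↔ c.2 < rowLen c.1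
  bounded : ∀ c : ℕ × ℕ, label c ≤ N
  fiber_domino : ∀ k : ℕ, 1 ≤ k → k ≤ N → ∃ c d : ℕ × ℕ, c ≠ d ∧ DominoAdj c d ∧
    ∀ e : ℕ × ℕ, label e = k ↔ (e = c ∨ e = d)
  row_mono : ∀ i j j' : ℕ, j ≤ j' → j' < rowLen i → label (i, j) ≤ label (i, j')
  row_strict : ∀ i j j' : ℕ, j < j' → j' < rowLen i → label (i, j) = label (i, j') → j' = j + 1
  col_mono : ∀ i i' j : ℕ, i ≤ i' → j < rowLen i → j < rowLen i' → label (i, j) ≤ label (i', j)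
  col_strict : ∀ i i' j : ℕ, i < i' → j < rowLen i → j < rowLen i' →
    label (i, j) = label (i', j) → i' = i + 1

/-- The row-length function of the rectangular shape with `m` rows of length `n`. -/
def rectShape (m n : ℕ) : ℕ → ℕ := fun i => if i < m then n else 0

/-- Domino tableaux of the rectangular shape `(n^m)` (`m` rows, `n` columns). -/
abbrev DTrect (m n : ℕ) := DominoTableau (rectShape m n) (m * n / 2)

/-- Domino tableaux of shape `(n, n)`, i.e. the `2 × n` rectangle, with `n` dominoes. -/
abbrev DT2 (n : ℕ) := DominoTableau (rectShape 2 n) n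

/-- `k` is the label of a bottom horizontal domino of `D` (a horizontal domino in row 2,
which is row index `1` here). -/
def IsBottomHorizontal (n : ℕ) (D : DT2 n) (k : ℕ) : Prop :=
  ∃ j : ℕ, j + 1 < n ∧ D.label (1, j) = k ∧ D.label (1, j + 1) = k

/-- `k` is the label of a vertical domino of `D`. -/
def IsVertical (n : ℕ) (D : DT2 n) (k : ℕ) : Prop :=
  ∃ j : ℕ, j < n ∧ D.label (0, j) = k ∧ D.label (1, j) = k

/-- The set of labels of bottom horizontal dominoes of `D` (the "reduced subset"). -/
def bhSet (n : ℕ) (D : DT2 n) : Set ℕ := {k | IsBottomHorizontal n D k}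

/-- The set of labels of vertical dominoes of `D`. -/
def vertSet (n : ℕ) (D : DT2 n) : Set ℕ := {k | IsVertical n D k}

/-- The map `Φ`: the labels of all bottom horizontal dominoes of `D`, together with the
smallest labels of vertical dominoes of `D`, taking as many of the latter as needed to
reach `⌊n/2⌋` elements. -/
def Phi (n : ℕ) (D : DT2 n) : Set ℕ :=
  bhSet n D ∪
    {v | v ∈ vertSet n D ∧ (vertSet n D ∩ Set.Iic v).ncard ≤ n / 2 - (bhSet n D).ncard}
/-- Two domino tableaux of shape `(n, n)` have the same underlying domino tiling:
within the diagram, two cells belong to the same domino of one tableau iff they belong to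
the same domino of the other. -/
def SameTiling (n : ℕ) (D₁ D₂ : DT2 n) : Prop :=
  ∀ c d : ℕ × ℕ, c.1 < 2 → c.2 < n → d.1 < 2 → d.2 < n →
    (D₁.label c = D₁.label d ↔ D₂.label c = D₂.label d)

/-- The tiling underlying `D` has a stack (a horizontal domino in row 1 atop a horizontal
domino in row 2) occupying columns `j` and `j + 1`. -/
def StackAt (n : ℕ) (D : DT2 n) (j : ℕ) : Prop :=
  j + 1 < n ∧ D.label (0, j) = D.label (0, j + 1)

/-- The tiling underlying `D` has a `k`-stack (a maximal run of `k` consecutive stacks)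
starting at column `j`. -/
def KStackAt (n : ℕ) (D : DT2 n) (j k : ℕ) : Prop :=
  (∀ i < k, StackAt n D (j + 2 * i)) ∧ ¬ StackAt n D (j + 2 * k) ∧
    (∀ j' : ℕ, j' + 2 = j → ¬ StackAt n D j')

namespace DominoTableau

variable {rowLen : ℕ → ℕ} {N : ℕ}

theorem ext_label {D E : DominoTableau rowLen N} (h : ∀ c, D.label c = E.label c) : D = E := by
  obtain ⟨l, _⟩ := D
  obtain ⟨l', _⟩ := E
  obtain rfl : l = l' := funext h
  rfl

/-- Interchanging the labels `v` and `v + 1` preserves the order of two labels that are not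
exactly `v` and `v + 1`. -/
theorem swap_succ_le_swap_succ {v x y : ℕ} (hxy : x ≤ y) (h : ¬ (x = v ∧ y = v + 1)) :
    Equiv.swap v (v + 1) x ≤ Equiv.swap v (v + 1) y := by
  simp only [Equiv.swap_apply_def]
  split_ifs <;> omega

/-- Interchange two consecutive labels whose dominoes share neither a row nor a column. -/
def swapLabels (D : DominoTableau rowLen N) (v : ℕ) (hv : 1 ≤ v) (hvN : v + 1 ≤ N)
    (hrow : ∀ i j j', D.label (i, j) = v → D.label (i, j') ≠ v + 1)
    (hcol : ∀ i i' j, D.label (i, j) = v → D.label (i', j) ≠ v + 1) :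
    DominoTableau rowLen N where
  label c := Equiv.swap v (v + 1) (D.label c)
  support c := by
    rw [← D.support c, Equiv.swap_apply_def]
    split_ifs <;> omega
  bounded c := by
    have := D.bounded c
    rw [Equiv.swap_apply_def]
    split_ifs <;> omega
  fiber_domino k hk hkN := by
    obtain ⟨c, d, hcd, hadj, h⟩ := D.fiber_domino (Equiv.swap v (v + 1) k)
      (by rw [Equiv.swap_apply_def]; split_ifs <;> omega)
      (by rw [Equiv.swap_apply_def]; split_ifs <;> omega)
    refine ⟨c, d, hcd, hadj, fun e => ?_⟩
    rw [← h e, Equiv.swap_apply_eq_iff]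
  row_mono i j j' hj hj' :=
    swap_succ_le_swap_succ (D.row_mono i j j' hj hj') fun h => hrow i j j' h.1 h.2
  row_strict i j j' hj hj' h := D.row_strict i j j' hj hj' ((Equiv.injective _) h)
  col_mono i i' j hi hj hj' :=
    swap_succ_le_swap_succ (D.col_mono i i' j hi hj hj') fun h => hcol i i' j h.1 h.2
  col_strict i i' j hi hj hj' h := D.col_strict i i' j hi hj hj' ((Equiv.injective _) h)

end DominoTableau

namespace DT2

variable {n : ℕ} (D : DT2 n)

theorem lt_rectShape {i j : ℕ} (hi : i < 2) (hj : j < n) : j < rectShape 2 n i := by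
  simpa [rectShape, hi] using hj

theorem label_ne_zero_iff (i j : ℕ) : D.label (i, j) ≠ 0 ↔ i < 2 ∧ j < n := by
  rw [D.support]
  simp only [rectShape]
  split_ifs <;> simp_all

theorem label_le_row {i j j' : ℕ} (hi : i < 2) (hj : j ≤ j') (hj' : j' < n) :
    D.label (i, j) ≤ D.label (i, j') :=
  D.row_mono i j j' hj (lt_rectShape hi hj')

theorem label_le_col {j : ℕ} (hj : j < n) : D.label (0, j) ≤ D.label (1, j) :=
  D.col_mono 0 1 j (by omega) (lt_rectShape (by omega) hj) (lt_rectShape (by omega) hj)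

/-- Every cell has exactly one partner, namely the other cell of its domino. -/
theorem exists_partner {i j : ℕ} (hi : i < 2) (hj : j < n) :
    ∃ d : ℕ × ℕ, DominoAdj (i, j) d ∧ d.1 < 2 ∧ d.2 < n ∧
      ∀ e : ℕ × ℕ, D.label e = D.label (i, j) ↔ e = (i, j) ∨ e = d := by
  have hne := (D.label_ne_zero_iff i j).2 ⟨hi, hj⟩
  obtain ⟨c, d, _, hadj, h⟩ := D.fiber_domino (D.label (i, j)) (by omega) (D.bounded _)
  have mem : ∀ e : ℕ × ℕ, D.label e = D.label (i, j) → e.1 < 2 ∧ e.2 < n := fun e he =>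
    (D.label_ne_zero_iff e.1 e.2).1 (by rw [Prod.mk.eta, he]; exact hne)
  rcases (h (i, j)).1 rfl with rfl | rfl
  · exact ⟨d, hadj, (mem d ((h d).2 (.inr rfl))).1, (mem d ((h d).2 (.inr rfl))).2, h⟩
  · refine ⟨c, ?_, (mem c ((h c).2 (.inl rfl))).1, (mem c ((h c).2 (.inl rfl))).2, fun e => ?_⟩
    · unfold DominoAdj at hadj ⊢
      omega
    · rw [h e, or_comm]

/-- No three distinct cells of the diagram carry the same label. -/
theorem eq_or_eq_or_eq_of_label_eq {c d e : ℕ × ℕ} (hc : c.1 < 2) (hc' : c.2 < n)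
    (hd : D.label d = D.label c) (he : D.label e = D.label c) : d = c ∨ e = c ∨ d = e := by
  obtain ⟨p, -, -, -, h⟩ := D.exists_partner hc hc'
  have h1 := (h d).1 hd
  have h2 := (h e).1 he
  aesop

theorem label_eq_cases {i j : ℕ} (hi : i < 2) (hj : j < n) :
    D.label (0, j) = D.label (1, j) ∨
      (j + 1 < n ∧ D.label (i, j) = D.label (i, j + 1)) ∨
      ∃ k, k + 1 = j ∧ D.label (i, k) = D.label (i, j) := by
  obtain ⟨⟨a, b⟩, hadj, ha, hb, h⟩ := D.exists_partner hi hj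
  have hl := (h (a, b)).2 (.inr rfl)
  simp only [DominoAdj] at hadj ha hb
  rcases hadj with ⟨rfl, rfl | rfl⟩ | ⟨rfl, h' | h'⟩
  · exact .inr (.inl ⟨hb, hl.symm⟩)
  · exact .inr (.inr ⟨b, rfl, hl⟩)
  · obtain rfl : i = 0 := by omega
    obtain rfl : a = 1 := by omega
    exact .inl hl.symm
  · obtain rfl : i = 1 := by omega
    obtain rfl : a = 0 := by omega
    exact .inl hl

/-- Each column holds a vertical domino, or the left half or the right half of a stack. -/
theorem column_cases {j : ℕ} (hj : j < n) :
    D.label (0, j) = D.label (1, j) ∨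
      (j + 1 < n ∧ D.label (0, j) = D.label (0, j + 1) ∧ D.label (1, j) = D.label (1, j + 1)) ∨
      ∃ k, k + 1 = j ∧ D.label (0, k) = D.label (0, j) ∧ D.label (1, k) = D.label (1, j) := by
  induction j with
  | zero =>
    have h0 := D.label_eq_cases (i := 0) (by omega) hj
    have h1 := D.label_eq_cases (i := 1) (by omega) hj
    simp only [Nat.add_eq_zero_iff, one_ne_zero, and_false, false_and, exists_false,
      or_false] at h0 h1
    tauto
  | succ j ih =>
    have key : ∀ i, i < 2 → D.label (i, j) = D.label (i, j + 1) →
        D.label (0, j) ≠ D.label (1, j) ∧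
          ∀ k, k + 1 = j → D.label (i, k) ≠ D.label (i, j) := by
      intro i hi h
      refine ⟨fun h' => ?_, fun k hk h' => ?_⟩
      · have := D.eq_or_eq_or_eq_of_label_eq (c := (i, j)) (d := (i, j + 1)) (e := (1 - i, j))
          hi (by simp; omega) h.symm (by interval_cases i <;> simp [h'])
        simp only [Prod.mk.injEq] at this
        omega
      · have := D.eq_or_eq_or_eq_of_label_eq (c := (i, j)) (d := (i, j + 1)) (e := (i, k))
          hi (by simp; omega) h.symm h'
        simp only [Prod.mk.injEq] at this
        omega
    rcases ih (by omega) with hV | ⟨-, hL⟩ | ⟨k, hk, hR⟩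
    · have h0 := D.label_eq_cases (i := 0) (by omega) hj
      have h1 := D.label_eq_cases (i := 1) (by omega) hj
      have k0 : D.label (0, j) ≠ D.label (0, j + 1) := fun h => (key 0 (by omega) h).1 hV
      have k1 : D.label (1, j) ≠ D.label (1, j + 1) := fun h => (key 1 (by omega) h).1 hV
      simp only [Nat.add_right_cancel_iff, exists_eq_left, k0, k1, or_false] at h0 h1
      tauto
    · exact .inr (.inr ⟨j, rfl, hL⟩)
    · have h0 := D.label_eq_cases (i := 0) (by omega) hj
      have h1 := D.label_eq_cases (i := 1) (by omega) hj
      have k0 : D.label (0, j) ≠ D.label (0, j + 1) := fun h => (key 0 (by omega) h).2 k hk hR.1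
      have k1 : D.label (1, j) ≠ D.label (1, j + 1) := fun h => (key 1 (by omega) h).2 k hk hR.2
      simp only [Nat.add_right_cancel_iff, exists_eq_left, k0, k1, or_false] at h0 h1
      tauto

variable {D}

theorem label_row_lt_of_eq_before {i j k : ℕ} (hi : i < 2) (hk : k + 1 = j) (hj : j + 1 < n)
    (h : D.label (i, k) = D.label (i, j)) : D.label (i, j) < D.label (i, j + 1) := by
  refine lt_of_le_of_ne (D.label_le_row hi (by omega) hj) fun h' => ?_
  have := D.eq_or_eq_or_eq_of_label_eq (c := (i, j)) (d := (i, k)) (e := (i, j + 1))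
    hi (by simp; omega) h h'.symm
  simp only [Prod.mk.injEq] at this
  omega

theorem label_row_lt_of_vertical {i j : ℕ} (hi : i < 2) (hj : j + 1 < n)
    (h : D.label (0, j) = D.label (1, j)) : D.label (i, j) < D.label (i, j + 1) := by
  refine lt_of_le_of_ne (D.label_le_row hi (by omega) hj) fun h' => ?_
  have := D.eq_or_eq_or_eq_of_label_eq (c := (i, j)) (d := (1 - i, j)) (e := (i, j + 1))
    hi (by simp; omega) (by interval_cases i <;> simp [h]) h'.symm
  simp only [Prod.mk.injEq] at this
  omega

theorem label_col_lt_of_stackAt {j : ℕ} (h : StackAt n D j) :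
    D.label (0, j) < D.label (1, j) := by
  obtain ⟨hj, h⟩ := h
  refine lt_of_le_of_ne (D.label_le_col (by omega)) fun h' => ?_
  have := (label_row_lt_of_vertical (i := 0) (by omega) hj h')
  omega

theorem label_bottom_eq_of_stackAt {j : ℕ} (h : StackAt n D j) :
    D.label (1, j) = D.label (1, j + 1) := by
  have hlt := label_col_lt_of_stackAt h
  obtain ⟨hj, h⟩ := h
  rcases D.column_cases (j := j) (by omega) with hV | ⟨-, hL⟩ | ⟨k, hk, hR⟩
  · omega
  · exact hL.2
  · have := label_row_lt_of_eq_before (i := 0) (by omega) hk hj hR.1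
    omega

/-- All labels to the left of the first stack of a run are smaller than the labels of that
stack. -/
theorem label_before_first_stack_lt {j j' : ℕ} (h : StackAt n D j)
    (hfirst : ∀ k, k + 2 = j → ¬ StackAt n D k) (hj' : j' < j) :
    D.label (1, j') < D.label (0, j) := by
  obtain ⟨m, rfl⟩ : ∃ m, j = m + 1 := ⟨j - 1, by omega⟩
  have hm := h.1
  have hle := D.label_le_row (i := 1) (j := j') (j' := m) (by omega) (by omega) (by omega)
  rcases D.column_cases (j := m) (by omega) with hV | ⟨-, hL⟩ | ⟨k, rfl, hR⟩
  · have := label_row_lt_of_vertical (i := 0) (by omega) (by omega) hV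
    omega
  · have := label_row_lt_of_eq_before (i := 0) (by omega) rfl hm hL.1
    exact absurd h.2 this.ne
  · exact absurd ⟨by omega, hR.1⟩ (hfirst k rfl)

theorem exists_swapLabels {v : ℕ} (hv : 1 ≤ v) (hvn : v + 1 ≤ n)
    (hrow : ∀ i j j', D.label (i, j) = v → D.label (i, j') ≠ v + 1)
    (hcol : ∀ i i' j, D.label (i, j) = v → D.label (i', j) ≠ v + 1) :
    ∃ D' : DT2 n, D' ≠ D ∧ SameTiling n D D' := by
  refine ⟨D.swapLabels v hv hvn hrow hcol, fun h => ?_, fun c d _ _ _ _ => ?_⟩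
  · obtain ⟨c, _, -, -, hc⟩ := D.fiber_domino v hv (by omega)
    have h1 : D.label c = v := (hc c).2 (.inl rfl)
    have h2 : Equiv.swap v (v + 1) (D.label c) = D.label c :=
      congrArg (fun E : DT2 n => E.label c) h
    rw [h1, Equiv.swap_apply_left] at h2
    omega
  · exact (Equiv.injective _).eq_iff.symm

theorem cell_of_label_eq_bottom {i j j' : ℕ} (h : StackAt n D j)
    (h' : D.label (i, j') = D.label (1, j)) : i = 1 ∧ (j' = j ∨ j' = j + 1) := by
  have := D.eq_or_eq_or_eq_of_label_eq (c := (1, j)) (d := (i, j')) (e := (1, j + 1))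
    (by simp) (by have := h.1; simp; omega) h' (label_bottom_eq_of_stackAt h).symm
  simp only [Prod.mk.injEq] at this
  omega

/-- If a run starts with two consecutive stacks, then the label of the bottom domino of the first
one can be interchanged with the label just below or just above it. -/
theorem exists_sameTiling_of_stackAt {j : ℕ} (h : StackAt n D j) (h2 : StackAt n D (j + 2))
    (hfirst : ∀ k, k + 2 = j → ¬ StackAt n D k) :
    ∃ D' : DT2 n, D' ≠ D ∧ SameTiling n D D' := by
  have hn := h2.1
  have hAB := label_col_lt_of_stackAt h
  have hCE := label_col_lt_of_stackAt h2
  have hAA := h.2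
  have hAC := label_row_lt_of_eq_before (i := 0) (k := j) (by omega) rfl (by omega) hAA
  simp only [add_assoc, Nat.reduceAdd] at hAC
  have hbn := D.bounded (1, j)
  have hcn := D.bounded (0, j + 2)
  have hne : D.label (0, j + 2) ≠ D.label (1, j) := fun e => by
    have := (cell_of_label_eq_bottom h e).1
    omega
  have hmem : ∀ i k, D.label (i, k) ≠ 0 → i < 2 ∧ k < n := fun i k => (D.label_ne_zero_iff i k).1
  have hcolle : ∀ i k, (k = j ∨ k = j + 1) → D.label (i, k) ≠ 0 → D.label (i, k) ≠ D.label (1, j) →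
      D.label (i, k) = D.label (0, j) := by
    intro i k hk h0 hne
    have hB := label_bottom_eq_of_stackAt h
    have := (hmem i k h0).1
    interval_cases i <;> rcases hk with rfl | rfl <;> omega
  have hright : ∀ k, j + 2 ≤ k → k < n → D.label (0, j + 2) < D.label (1, k) := fun k hk hkn =>
    hCE.trans_le (D.label_le_row (by omega) hk hkn)
  have hleft : ∀ k, k < j → D.label (1, k) < D.label (0, j) := fun k hk =>
    label_before_first_stack_lt h hfirst hk
  rcases lt_or_gt_of_ne hne with hlt | hgt
  · obtain ⟨v, hv⟩ : ∃ v, D.label (1, j) = v + 1 := ⟨D.label (1, j) - 1, by omega⟩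
    refine exists_swapLabels (v := v) (by omega) (by omega) ?_ ?_
    · intro i k k' e e'
      obtain ⟨rfl, hk'⟩ := cell_of_label_eq_bottom h (e'.trans hv.symm)
      have hk := (hmem 1 k (by omega)).2
      rcases lt_trichotomy k j with hkj | rfl | hkj
      · have := hleft k hkj
        omega
      · omega
      · have := D.label_le_row (i := 1) (by omega) hkj.le hk
        omega
    · intro i i' k e e'
      obtain ⟨rfl, hk'⟩ := cell_of_label_eq_bottom h (e'.trans hv.symm)
      have := hcolle i k hk' (by omega) (by omega)
      omega
  · refine exists_swapLabels (v := D.label (1, j)) (by omega) (by omega) ?_ ?_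
    · intro i k k' e e'
      obtain ⟨rfl, hk⟩ := cell_of_label_eq_bottom h e
      have hk' := (hmem 1 k' (by omega)).2
      rcases le_or_gt (j + 2) k' with hkj | hkj
      · have := hright k' hkj hk'
        omega
      · have h1 := D.label_le_row (i := 1) (j := k') (j' := j + 1) (by omega) (by omega) (by omega)
        have h2 := label_bottom_eq_of_stackAt h
        omega
    · intro i i' k e e'
      obtain ⟨rfl, hk'⟩ := cell_of_label_eq_bottom h e
      have := hcolle i' k hk' (by omega) (by omega)
      omega

/-- Two consecutive stacks extend to a maximal run of stacks. -/
theorem exists_kStackAt_of_stackAt {j : ℕ} (h : StackAt n D j) (h2 : StackAt n D (j + 2)) :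
    ∃ j k : ℕ, 2 ≤ k ∧ KStackAt n D j k := by
  induction j using Nat.strong_induction_on with
  | _ j ih =>
    by_cases hfirst : ∃ j', j' + 2 = j ∧ StackAt n D j'
    · obtain ⟨j', rfl, hj'⟩ := hfirst
      exact ih j' (by omega) hj' h
    · push Not at hfirst
      have hex : ∃ k, ¬ StackAt n D (j + 2 * k) := ⟨n, fun hs => by have := hs.1; omega⟩
      refine ⟨j, Nat.find hex, ?_, fun i hi => not_not.1 (Nat.find_min hex hi),
        Nat.find_spec hex, hfirst⟩
      rw [Nat.le_find_iff]
      intro m hm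
      interval_cases m <;> simpa

/-- The label of the `j`-th domino of a tiling without two consecutive stacks, when the dominoes
are listed from left to right and from top to bottom within a stack. -/
noncomputable def readingLabel (D : DT2 n) (j : ℕ) : ℕ :=
  if StackAt n D j then D.label (0, j) else D.label (1, j)

theorem readingLabel_lt_succ (hno : ∀ j, StackAt n D j → ¬ StackAt n D (j + 2)) {j : ℕ}
    (hj : j + 1 < n) : readingLabel D j < readingLabel D (j + 1) := by
  unfold readingLabel
  by_cases hs : StackAt n D j
  · have hs' : ¬ StackAt n D (j + 1) := fun h' => by
      have := label_row_lt_of_eq_before (i := 0) (by omega) rfl h'.1 hs.2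
      exact this.ne h'.2
    rw [if_pos hs, if_neg hs', ← label_bottom_eq_of_stackAt hs]
    exact label_col_lt_of_stackAt hs
  · rw [if_neg hs]
    rcases D.column_cases (j := j) (by omega) with hV | ⟨-, hL⟩ | ⟨k, rfl, hR⟩
    · split_ifs
      · rw [← hV]
        exact label_row_lt_of_vertical (by omega) hj hV
      · exact label_row_lt_of_vertical (by omega) hj hV
    · exact absurd ⟨hj, hL.1⟩ hs
    · rw [if_neg (hno k ⟨by omega, hR.1⟩)]
      exact label_row_lt_of_eq_before (by omega) rfl hj hR.2

theorem readingLabel_eq (hno : ∀ j, StackAt n D j → ¬ StackAt n D (j + 2)) {j : ℕ}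
    (hj : j < n) : readingLabel D j = j + 1 := by
  have hlow : ∀ j, j < n → j + 1 ≤ readingLabel D j := by
    intro j hj
    induction j with
    | zero =>
      have h0 := (D.label_ne_zero_iff 0 0).2 ⟨by omega, hj⟩
      have h1 := (D.label_ne_zero_iff 1 0).2 ⟨by omega, hj⟩
      unfold readingLabel
      split_ifs <;> omega
    | succ j ih =>
      have := ih (by omega)
      have := readingLabel_lt_succ hno hj
      omega
  have hupp : ∀ m j, j + m + 1 = n → readingLabel D j ≤ j + 1 := by
    intro m
    induction m with
    | zero =>
      intro j hj
      have h0 := D.bounded (0, j)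
      have h1 := D.bounded (1, j)
      unfold readingLabel
      split_ifs <;> omega
    | succ m ih =>
      intro j hj
      have := ih (j + 1) (by omega)
      have := readingLabel_lt_succ hno (j := j) (by omega)
      omega
  exact le_antisymm (hupp (n - 1 - j) j (by omega)) (hlow j hj)

theorem _root_.SameTiling.stackAt_iff {D' : DT2 n} (h : SameTiling n D D') (j : ℕ) :
    StackAt n D j ↔ StackAt n D' j :=
  and_congr_right fun hj => h (0, j) (0, j + 1) (by simp) (by simp; omega) (by simp) hj

theorem label_of_stackAt (hno : ∀ j, StackAt n D j → ¬ StackAt n D (j + 2)) {j : ℕ}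
    (h : StackAt n D j) : D.label (0, j) = j + 1 ∧ D.label (1, j) = j + 2 := by
  have hj := h.1
  have h0 := readingLabel_eq hno (j := j) (by omega)
  have h1 := readingLabel_eq hno hj
  have hs' : ¬ StackAt n D (j + 1) := fun h' => by
    have := label_row_lt_of_eq_before (i := 0) (by omega) rfl h'.1 h.2
    exact this.ne h'.2
  rw [readingLabel, if_pos h] at h0
  rw [readingLabel, if_neg hs', ← label_bottom_eq_of_stackAt h] at h1
  exact ⟨h0, h1⟩

theorem label_of_vertical (hno : ∀ j, StackAt n D j → ¬ StackAt n D (j + 2)) {j : ℕ} (hj : j < n)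
    (h : D.label (0, j) = D.label (1, j)) : D.label (0, j) = j + 1 := by
  have h0 := readingLabel_eq hno hj
  rwa [readingLabel, ← h, ite_self] at h0

theorem eq_of_sameTiling (hno : ∀ j, StackAt n D j → ¬ StackAt n D (j + 2)) {D' : DT2 n}
    (h : SameTiling n D D') : D' = D := by
  have hno' : ∀ j, StackAt n D' j → ¬ StackAt n D' (j + 2) := fun j => by
    rw [← h.stackAt_iff, ← h.stackAt_iff]
    exact hno j
  have hstack : ∀ j, StackAt n D j →
      D'.label (0, j) = D.label (0, j) ∧ D'.label (1, j) = D.label (1, j) := fun j hs => by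
    have h1 := label_of_stackAt hno hs
    have h2 := label_of_stackAt hno' ((h.stackAt_iff j).1 hs)
    omega
  have hcol : ∀ j, j < n →
      D'.label (0, j) = D.label (0, j) ∧ D'.label (1, j) = D.label (1, j) := by
    intro j hj
    rcases D.column_cases hj with hV | ⟨hj', hL⟩ | ⟨k, rfl, hR⟩
    · have hV' := (h (0, j) (1, j) (by simp) hj (by simp) hj).1 hV
      have h1 := label_of_vertical hno hj hV
      have h2 := label_of_vertical hno' hj hV'
      omega
    · exact hstack j ⟨hj', hL.1⟩
    · have hs : StackAt n D k := ⟨hj, hR.1⟩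
      have hs' := (h.stackAt_iff k).1 hs
      have := hstack k hs
      rw [← hR.1, ← hR.2, ← hs'.2, ← label_bottom_eq_of_stackAt hs']
      exact this
  refine DominoTableau.ext_label fun c => ?_
  obtain ⟨i, j⟩ := c
  by_cases hc : i < 2 ∧ j < n
  · obtain ⟨hi, hj⟩ := hc
    interval_cases i
    · exact (hcol j hj).1
    · exact (hcol j hj).2
  · rw [← D.label_ne_zero_iff, not_not] at hc
    have hc' : D'.label (i, j) = 0 := by
      by_contra h0
      exact (D.label_ne_zero_iff i j).2 ((D'.label_ne_zero_iff i j).1 h0) hc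
    rw [hc, hc']

end DT2

/-- A domino tiling of the `2 × n` rectangle admits more than one
increasing labeling if and only if it contains a `k`-stack with `k ≥ 2`. -/
theorem dt_tiling_multiple_labelings_iff_double_stack (n : ℕ) (D : DT2 n) :
    (∃ D' : DT2 n, D' ≠ D ∧ SameTiling n D D') ↔
      ∃ j k : ℕ, 2 ≤ k ∧ KStackAt n D j k := by
  constructor
  · rintro ⟨D', hne, h⟩
    by_contra hk
    exact hne (DT2.eq_of_sameTiling
      (fun j h1 h2 => hk (DT2.exists_kStackAt_of_stackAt h1 h2)) h)
  · rintro ⟨j, k, hk, hrun, -, hfirst⟩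
    exact DT2.exists_sameTiling_of_stackAt (hrun 0 (by omega)) (hrun 1 (by omega)) hfirst
end

section
/- For every n ≥ 1, the map sending a domino tableau D of shape (n,n) to the binary word w = a_1…a_n with a_i = 0 if and only if i ∈ Φ(D) is a bijection from DT((n,n)) to the set W_{n,⌊n/2⌋} of binary words of length n with exactly ⌊n/2⌋ zeros; moreover this bijection preserves descent sets, i.e., Des(D) equals the descent set of the corresponding word (where i is a descent of a word a_1…a_n when a_i = 1 and a_{i+1} = 0). -/
open scoped Classical

/-- The row (0-indexed) of the northeast-most cell of the domino of `D` labeled `k`: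
row `0` if the domino touches the first row, and row `1` otherwise. -/
noncomputable def neRow (n : ℕ) (D : DT2 n) (k : ℕ) : ℕ :=
  if ∃ j : ℕ, j < n ∧ D.label (0, j) = k then 0 else 1

/-- The descent set of a domino tableau `D` of shape `(n, n)`: those `i` for which the
northeast-most cell of the domino labeled `i + 1` lies in a row strictly below the row of
the northeast-most cell of the domino labeled `i`. -/
def DesD (n : ℕ) (D : DT2 n) : Set ℕ :=
  {i | 1 ≤ i ∧ i + 1 ≤ n ∧ neRow n D i < neRow n D (i + 1)}
/-- The binary word `a_1 a_2 ⋯` associated to `D`: `a_i = 0` iff `i ∈ Φ(D)` (and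
`a_i = 1` for positions outside `{1, …, n}`). -/
noncomputable def wordOf (n : ℕ) (D : DT2 n) : ℕ → ℕ := fun i => if i ∈ Phi n D then 0 else 1

/-- Binary words of length `n` with exactly `k` zeros, encoded as functions `ℕ → ℕ`
taking values in `{0, 1}`, equal to `1` outside the positions `1, …, n`. -/
def Words (n k : ℕ) : Set (ℕ → ℕ) :=
  {w | (∀ i, w i ≤ 1) ∧ (∀ i, w i = 0 → 1 ≤ i ∧ i ≤ n) ∧ {i | w i = 0}.ncard = k}

/-- The descent set of a binary word: positions `i ≥ 1` with `a_i = 1` and `a_{i+1} = 0`. -/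
def DesW (w : ℕ → ℕ) : Set ℕ := {i | 1 ≤ i ∧ w i = 1 ∧ w (i + 1) = 0}

open Finset

section Counting

theorem lt_card_filter_range_iff {n : ℕ} {p : ℕ → Prop} [DecidablePred p]
    (hp : ∀ i j, i ≤ j → j < n → p j → p i) {j : ℕ} (hj : j < n) :
    j < #{i ∈ range n | p i} ↔ p j := by
  constructor
  · intro h
    by_contra hpj
    have hsub : {i ∈ range n | p i} ⊆ range j := by
      intro i hi
      simp only [mem_filter, mem_range] at hi ⊢
      by_contra hij
      exact hpj (hp j i (by omega) hi.1 hi.2)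
    have := card_le_card hsub
    rw [card_range] at this
    omega
  · intro h
    have hsub : range (j + 1) ⊆ {i ∈ range n | p i} := by
      intro i hi
      simp only [mem_filter, mem_range] at hi ⊢
      exact ⟨by omega, hp i j (by omega) hj h⟩
    have := card_le_card hsub
    rw [card_range] at this
    omega

/-- The `m` smallest elements of a finite set, selected by their rank, number
`min m #s`. -/
theorem card_filter_rank_le (s : Finset ℕ) (m : ℕ) :
    #{v ∈ s | #{u ∈ s | u ≤ v} ≤ m} = min m #s := by
  induction s using Finset.induction_on_max with
  | empty => simp
  | insert a s ha ih =>
    have has : a ∉ s := fun h => lt_irrefl a (ha a h)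
    have hold : ∀ v ∈ s, #{u ∈ insert a s | u ≤ v} = #{u ∈ s | u ≤ v} := by
      intro v hv
      rw [filter_insert, if_neg (not_le.2 (ha v hv))]
    have hnew : {u ∈ insert a s | u ≤ a} = insert a s := by
      apply filter_true_of_mem
      intro u hu
      rcases mem_insert.1 hu with rfl | hu
      · exact le_rfl
      · exact (ha u hu).le
    rw [filter_insert, hnew, card_insert_of_notMem has,
      filter_congr (fun v hv => by rw [hold v hv])]
    split_ifs with h
    · rw [card_insert_of_notMem (by simp [has]), ih]
      omega
    · rw [ih]
      omega

end Counting

section Height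

variable {n : ℕ} (D : DT2 n)

/-- The number of cells in row `i` of `D` whose label is at most `k`. -/
def rowCount (i k : ℕ) : ℕ := #{j ∈ range n | D.label (i, j) ≤ k}

theorem rectShape_two_of_lt {i : ℕ} (hi : i < 2) : rectShape 2 n i = n := if_pos hi

theorem lt_rowCount_iff {i j : ℕ} (k : ℕ) (hi : i < 2) (hj : j < n) :
    j < rowCount D i k ↔ D.label (i, j) ≤ k := by
  refine lt_card_filter_range_iff (p := fun j => D.label (i, j) ≤ k) ?_ hj
  intro a b hab hb h
  exact (D.row_mono i a b hab (by rwa [rectShape_two_of_lt hi])).trans h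

theorem one_le_label {i j : ℕ} (hi : i < 2) (hj : j < n) : 1 ≤ D.label (i, j) :=
  Nat.one_le_iff_ne_zero.2 ((D.support (i, j)).2 (by simpa [rectShape_two_of_lt hi] using hj))

theorem lt_of_label_eq_succ {c : ℕ × ℕ} {k : ℕ} (h : D.label c = k + 1) :
    c.1 < 2 ∧ c.2 < n := by
  have := (D.support c).1 (by omega)
  unfold rectShape at this
  split_ifs at this with h2
  · exact ⟨h2, this⟩
  · omega

theorem rowCount_zero {i : ℕ} (hi : i < 2) : rowCount D i 0 = 0 := by
  rw [rowCount, card_eq_zero, filter_eq_empty_iff]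
  intro j hj
  have := one_le_label D hi (mem_range.1 hj)
  omega

theorem rowCount_self (i : ℕ) : rowCount D i n = n := by
  rw [rowCount, filter_true_of_mem (fun j _ => D.bounded (i, j)), card_range]

theorem rowCount_one_le (k : ℕ) : rowCount D 1 k ≤ rowCount D 0 k := by
  apply card_le_card
  intro j hj
  simp only [mem_filter, mem_range] at hj ⊢
  exact ⟨hj.1, (D.col_mono 0 1 j (by omega) (by simpa [rectShape] using hj.1)
    (by simpa [rectShape] using hj.1)).trans hj.2⟩

theorem rowCount_succ (i k : ℕ) :
    rowCount D i (k + 1) = rowCount D i k + #{j ∈ range n | D.label (i, j) = k + 1} := by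
  rw [rowCount, rowCount, ← card_union_of_disjoint]
  · congr 1
    ext j
    simp only [mem_filter, mem_union, mem_range]
    omega
  · rw [disjoint_filter]
    intro j _ h
    omega

/-- The fibre of a label is a horizontal domino in one of the two rows, or a vertical domino. -/
theorem exists_domino {k : ℕ} (hk : k < n) :
    (∃ i j, i < 2 ∧ j + 1 < n ∧ ∀ e, D.label e = k + 1 ↔ (e = (i, j) ∨ e = (i, j + 1))) ∨
    (∃ j, j < n ∧ ∀ e, D.label e = k + 1 ↔ (e = (0, j) ∨ e = (1, j))) := by
  obtain ⟨⟨a, b⟩, ⟨a', b'⟩, -, hadj, h⟩ := D.fiber_domino (k + 1) (by omega) (by omega)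
  have h1 := lt_of_label_eq_succ D ((h (a, b)).2 (Or.inl rfl))
  have h2 := lt_of_label_eq_succ D ((h (a', b')).2 (Or.inr rfl))
  simp only [DominoAdj] at hadj h1 h2
  rcases hadj with ⟨rfl, rfl | rfl⟩ | ⟨rfl, rfl | rfl⟩
  · exact Or.inl ⟨a, b, h1.1, h2.2, h⟩
  · exact Or.inl ⟨a, b', h1.1, h1.2, fun e => (h e).trans or_comm⟩
  · obtain rfl : a = 0 := by omega
    exact Or.inr ⟨b, h1.2, h⟩
  · obtain rfl : a' = 0 := by omega
    exact Or.inr ⟨b, h1.2, fun e => (h e).trans or_comm⟩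

/-- Adding the domino labelled `k + 1` changes the row counts according to its type. -/
theorem rowCount_step {k : ℕ} (hk : k < n) :
    (rowCount D 0 (k + 1) = rowCount D 0 k + 2 ∧ rowCount D 1 (k + 1) = rowCount D 1 k ∧
      ¬ IsBottomHorizontal n D (k + 1) ∧ ¬ IsVertical n D (k + 1) ∧ neRow n D (k + 1) = 0) ∨
    (rowCount D 0 (k + 1) = rowCount D 0 k ∧ rowCount D 1 (k + 1) = rowCount D 1 k + 2 ∧
      IsBottomHorizontal n D (k + 1) ∧ ¬ IsVertical n D (k + 1) ∧ neRow n D (k + 1) = 1) ∨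
    (rowCount D 0 (k + 1) = rowCount D 0 k + 1 ∧ rowCount D 1 (k + 1) = rowCount D 1 k + 1 ∧
      rowCount D 0 k = rowCount D 1 k ∧
      ¬ IsBottomHorizontal n D (k + 1) ∧ IsVertical n D (k + 1) ∧ neRow n D (k + 1) = 0) := by
  have hpair : ∀ j, j + 1 < n → #{x ∈ range n | x = j ∨ x = j + 1} = 2 := by
    intro j hj
    have : {x ∈ range n | x = j ∨ x = j + 1} = {j, j + 1} := by
      ext x
      simp only [mem_filter, mem_range, mem_insert, mem_singleton]
      omega
    rw [this, card_pair (by omega)]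
  have hsing : ∀ j, j < n → #{x ∈ range n | x = j} = 1 := by
    intro j hj
    have : {x ∈ range n | x = j} = {j} := by
      ext x
      simp only [mem_filter, mem_range, mem_singleton]
      omega
    rw [this, card_singleton]
  rcases exists_domino D hk with ⟨i, j, hi, hj, h⟩ | ⟨j, hj, h⟩
  · obtain rfl | rfl : i = 0 ∨ i = 1 := by omega
    · refine Or.inl ⟨?_, ?_, ?_, ?_, ?_⟩
      · rw [rowCount_succ]
        simp only [h, Prod.mk.injEq, true_and]
        rw [hpair j hj]
      · rw [rowCount_succ]
        simp [h]
      · simp [IsBottomHorizontal, h]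
      · simp [IsVertical, h]
      · rw [neRow, if_pos ⟨j, by omega, (h _).2 (Or.inl rfl)⟩]
    · refine Or.inr (Or.inl ⟨?_, ?_, ?_, ?_, ?_⟩)
      · rw [rowCount_succ]
        simp [h]
      · rw [rowCount_succ]
        simp only [h, Prod.mk.injEq, true_and]
        rw [hpair j hj]
      · exact ⟨j, hj, (h _).2 (Or.inl rfl), (h _).2 (Or.inr rfl)⟩
      · simp [IsVertical, h]
      · rw [neRow, if_neg (by simp [h])]
  · have e0 : rowCount D 0 (k + 1) = rowCount D 0 k + 1 := by
      rw [rowCount_succ]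
      simp only [h, Prod.mk.injEq, true_and, zero_ne_one, false_and, or_false]
      rw [hsing j hj]
    have e1 : rowCount D 1 (k + 1) = rowCount D 1 k + 1 := by
      rw [rowCount_succ]
      simp only [h, Prod.mk.injEq, true_and, one_ne_zero, false_and, false_or]
      rw [hsing j hj]
    have l0 := (h (0, j)).2 (Or.inl rfl)
    have l1 := (h (1, j)).2 (Or.inr rfl)
    refine Or.inr (Or.inr ⟨e0, e1, ?_, ?_, ⟨j, hj, l0, l1⟩, ?_⟩)
    · have a0 := lt_rowCount_iff D (i := 0) k (by omega) hj
      have a1 := lt_rowCount_iff D (i := 1) k (by omega) hj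
      have b0 := lt_rowCount_iff D (i := 0) (k + 1) (by omega) hj
      have b1 := lt_rowCount_iff D (i := 1) (k + 1) (by omega) hj
      omega
    · rintro ⟨x, _, hx, hx'⟩
      simp only [h, Prod.mk.injEq] at hx hx'
      omega
    · rw [neRow, if_pos ⟨j, hj, l0⟩]

/-- Half the difference of the row lengths of the subtableau of labels at most `k`. -/
def height (k : ℕ) : ℕ := rowCount D 0 k - k

theorem rowCount_eq {k : ℕ} (hk : k ≤ n) :
    rowCount D 0 k = k + height D k ∧ rowCount D 1 k + height D k = k := by
  have hsum : rowCount D 0 k + rowCount D 1 k = 2 * k := by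
    induction k with
    | zero => rw [rowCount_zero D (by omega), rowCount_zero D (by omega)]
    | succ k ih =>
      have := ih (by omega)
      rcases rowCount_step D (k := k) (by omega) with h | h | h <;> omega
  have := rowCount_one_le D k
  unfold height
  omega

/-- Lattice paths of length `n` from height `0` to height `0` with steps `1`, `-1` and,
only at height `0`, also `0`. -/
structure IsTableauPath (n : ℕ) (d : ℕ → ℕ) : Prop where
  start : d 0 = 0
  finish : d n = 0
  step : ∀ k < n, d (k + 1) = d k + 1 ∨ d k = d (k + 1) + 1 ∨ (d k = 0 ∧ d (k + 1) = 0)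

theorem isTableauPath_height : IsTableauPath n (height D) where
  start := by simp [height, rowCount_zero D]
  finish := by simp [height, rowCount_self D]
  step k hk := by
    have h1 := rowCount_eq D hk.le
    have h2 := rowCount_eq D (k := k + 1) hk
    rcases rowCount_step D hk with h | h | h <;> omega

theorem isBottomHorizontal_succ_iff {k : ℕ} (hk : k < n) :
    IsBottomHorizontal n D (k + 1) ↔ height D k = height D (k + 1) + 1 := by
  have h1 := rowCount_eq D hk.le
  have h2 := rowCount_eq D (k := k + 1) hk
  rcases rowCount_step D hk with h | h | h
  · exact iff_of_false h.2.2.1 (by omega)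
  · exact iff_of_true h.2.2.1 (by omega)
  · exact iff_of_false h.2.2.2.1 (by omega)

theorem isVertical_succ_iff {k : ℕ} (hk : k < n) :
    IsVertical n D (k + 1) ↔ height D k = height D (k + 1) := by
  have h1 := rowCount_eq D hk.le
  have h2 := rowCount_eq D (k := k + 1) hk
  rcases rowCount_step D hk with h | h | h
  · exact iff_of_false h.2.2.2.1 (by omega)
  · exact iff_of_false h.2.2.2.1 (by omega)
  · exact iff_of_true h.2.2.2.2.1 (by omega)

theorem neRow_succ {k : ℕ} (hk : k < n) :
    neRow n D (k + 1) = if height D k = height D (k + 1) + 1 then 1 else 0 := by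
  have h1 := rowCount_eq D hk.le
  have h2 := rowCount_eq D (k := k + 1) hk
  rcases rowCount_step D hk with h | h | h <;> split_ifs <;> omega

theorem mem_bhSet_iff (v : ℕ) :
    v ∈ bhSet n D ↔ ∃ k < n, v = k + 1 ∧ height D k = height D (k + 1) + 1 := by
  constructor
  · rintro ⟨j, hj, h, h'⟩
    have h1 := one_le_label D (i := 1) (by omega) hj
    have h2 := D.bounded (1, j + 1)
    obtain ⟨k, rfl⟩ : ∃ k, v = k + 1 := ⟨v - 1, by omega⟩
    exact ⟨k, by omega, rfl, (isBottomHorizontal_succ_iff D (by omega)).1 ⟨j, hj, h, h'⟩⟩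
  · rintro ⟨k, hk, rfl, h⟩
    exact (isBottomHorizontal_succ_iff D hk).2 h

theorem mem_vertSet_iff (v : ℕ) :
    v ∈ vertSet n D ↔ ∃ k < n, v = k + 1 ∧ height D k = height D (k + 1) := by
  constructor
  · rintro ⟨j, hj, h, h'⟩
    have h1 := one_le_label D (i := 1) (by omega) hj
    have h2 := D.bounded (1, j)
    obtain ⟨k, rfl⟩ : ∃ k, v = k + 1 := ⟨v - 1, by omega⟩
    exact ⟨k, by omega, rfl, (isVertical_succ_iff D (by omega)).1 ⟨j, hj, h, h'⟩⟩
  · rintro ⟨k, hk, rfl, h⟩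
    exact (isVertical_succ_iff D hk).2 h

/-- A tableau is determined by its height function. -/
theorem eq_of_height_eq {D D' : DT2 n} (h : ∀ k ≤ n, height D k = height D' k) : D = D' := by
  have hcell : ∀ i j, i < 2 → j < n → D.label (i, j) = D'.label (i, j) := by
    intro i j hi hj
    have hle : ∀ k ≤ n, (D.label (i, j) ≤ k ↔ D'.label (i, j) ≤ k) := by
      intro k hk
      rw [← lt_rowCount_iff D k hi hj, ← lt_rowCount_iff D' k hi hj]
      have h1 := rowCount_eq D hk
      have h2 := rowCount_eq D' hk
      have := h k hk
      obtain rfl | rfl : i = 0 ∨ i = 1 := by omega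
      · omega
      · omega
    exact le_antisymm ((hle _ (D'.bounded _)).2 le_rfl) ((hle _ (D.bounded _)).1 le_rfl)
  have hlabel : D.label = D'.label := by
    funext ⟨i, j⟩
    by_cases hij : i < 2 ∧ j < n
    · exact hcell i j hij.1 hij.2
    · have hz : ∀ E : DT2 n, E.label (i, j) = 0 := by
        intro E
        by_contra h0
        obtain ⟨k, hk⟩ := Nat.exists_eq_succ_of_ne_zero h0
        exact hij (lt_of_label_eq_succ E hk)
      rw [hz D, hz D']
  cases D
  cases D'
  cases hlabel
  rfl

end Height

section OfPath

variable {n : ℕ} {d : ℕ → ℕ}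

theorem IsTableauPath.le (hd : IsTableauPath n d) {k : ℕ} (hk : k ≤ n) : d k ≤ k := by
  induction k with
  | zero => exact hd.start.le
  | succ k ih =>
    have := ih (by omega)
    have := hd.step k hk
    omega

/-- The length of row `i` of the subtableau of labels at most `k`, in the tableau with
height function `d`. -/
def rowEnd (d : ℕ → ℕ) (i k : ℕ) : ℕ := if i = 0 then k + d k else k - d k

theorem rowEnd_finish (hd : IsTableauPath n d) (i : ℕ) : rowEnd d i n = n := by
  simp [rowEnd, hd.finish]

theorem rowEnd_start (hd : IsTableauPath n d) (i : ℕ) : rowEnd d i 0 = 0 := by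
  simp [rowEnd, hd.start]

theorem rowEnd_one_le (k : ℕ) : rowEnd d 1 k ≤ rowEnd d 0 k := by
  simp only [rowEnd, one_ne_zero, if_true, if_false]
  omega

theorem rowEnd_succ (hd : IsTableauPath n d) (i : ℕ) {k : ℕ} (hk : k < n) :
    rowEnd d i k ≤ rowEnd d i (k + 1) ∧ rowEnd d i (k + 1) ≤ rowEnd d i k + 2 := by
  have h1 := hd.step k hk
  have h2 := hd.le hk.le
  have h3 := hd.le (k := k + 1) hk
  unfold rowEnd
  split_ifs <;> omega

theorem rowEnd_mono (hd : IsTableauPath n d) (i : ℕ) {k l : ℕ} (hkl : k ≤ l) (hl : l ≤ n) :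
    rowEnd d i k ≤ rowEnd d i l := by
  induction l, hkl using Nat.le_induction with
  | base => exact le_rfl
  | succ l _ ih => exact (ih (by omega)).trans (rowEnd_succ hd i hl).1

/-- The label function of the tableau with height function `d`. -/
def pathLabel (n : ℕ) (d : ℕ → ℕ) (c : ℕ × ℕ) : ℕ :=
  if c.1 < 2 ∧ c.2 < n then #{k ∈ range n | rowEnd d c.1 k ≤ c.2} else 0

theorem pathLabel_le (c : ℕ × ℕ) : pathLabel n d c ≤ n := by
  unfold pathLabel
  split_ifs
  · exact (card_filter_le _ _).trans (card_range n).le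
  · exact Nat.zero_le n

theorem pathLabel_le_iff (hd : IsTableauPath n d) {i j k : ℕ} (hi : i < 2) (hj : j < n)
    (hk : k ≤ n) : pathLabel n d (i, j) ≤ k ↔ j < rowEnd d i k := by
  rcases hk.eq_or_lt with rfl | hk
  · exact iff_of_true (pathLabel_le _) (by rwa [rowEnd_finish hd])
  · rw [pathLabel, if_pos ⟨hi, hj⟩, ← not_lt, ← not_le (a := rowEnd d i k), not_iff_not]
    refine lt_card_filter_range_iff (p := fun k => rowEnd d i k ≤ j) ?_ hk
    intro a b hab hb h
    exact (rowEnd_mono hd i hab hb.le).trans h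

theorem pathLabel_eq_succ_iff (hd : IsTableauPath n d) {c : ℕ × ℕ} {k : ℕ} (hk : k < n) :
    pathLabel n d c = k + 1 ↔ c.1 < 2 ∧ rowEnd d c.1 k ≤ c.2 ∧ c.2 < rowEnd d c.1 (k + 1) := by
  obtain ⟨i, j⟩ := c
  have hn : rowEnd d i (k + 1) ≤ n :=
    (rowEnd_mono hd i hk le_rfl).trans (rowEnd_finish hd i).le
  by_cases hij : i < 2 ∧ j < n
  · have h1 := pathLabel_le_iff hd hij.1 hij.2 hk.le
    have h2 := pathLabel_le_iff hd hij.1 hij.2 (k := k + 1) hk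
    simp only
    omega
  · rw [pathLabel, if_neg hij]
    simp only
    omega

theorem pathLabel_ne_zero_iff (hd : IsTableauPath n d) (c : ℕ × ℕ) :
    pathLabel n d c ≠ 0 ↔ c.1 < 2 ∧ c.2 < n := by
  obtain ⟨i, j⟩ := c
  by_cases hij : i < 2 ∧ j < n
  · have := pathLabel_le_iff hd hij.1 hij.2 (k := 0) (by omega)
    rw [rowEnd_start hd] at this
    simp only
    omega
  · rw [pathLabel, if_neg hij]
    simp only
    omega

theorem lt_rectShape_two_iff {i j : ℕ} : j < rectShape 2 n i ↔ i < 2 ∧ j < n := by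
  unfold rectShape
  split_ifs <;> omega

/-- The domino tableau with height function `d`. -/
def tableauOfPath (hd : IsTableauPath n d) : DT2 n where
  label := pathLabel n d
  support c := by rw [pathLabel_ne_zero_iff hd, lt_rectShape_two_iff]
  bounded := pathLabel_le
  fiber_domino := by
    intro k h1 hk
    obtain ⟨k, rfl⟩ : ∃ m, k = m + 1 := ⟨k - 1, by omega⟩
    have hle := hd.le (k := k) (by omega)
    have hle' := hd.le hk
    rcases hd.step k hk with h | h | h
    · refine ⟨(0, k + d k), (0, k + d k + 1), by simp, Or.inl ⟨rfl, Or.inl rfl⟩, ?_⟩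
      rintro ⟨i, j⟩
      rw [pathLabel_eq_succ_iff hd hk]
      simp only [rowEnd, Prod.mk.injEq]
      split_ifs <;> omega
    · refine ⟨(1, k - d k), (1, k - d k + 1), by simp, Or.inl ⟨rfl, Or.inl rfl⟩, ?_⟩
      rintro ⟨i, j⟩
      rw [pathLabel_eq_succ_iff hd hk]
      simp only [rowEnd, Prod.mk.injEq]
      split_ifs <;> omega
    · refine ⟨(0, k), (1, k), by simp, Or.inr ⟨rfl, Or.inl rfl⟩, ?_⟩
      rintro ⟨i, j⟩
      rw [pathLabel_eq_succ_iff hd hk]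
      simp only [rowEnd, Prod.mk.injEq]
      split_ifs <;> omega
  row_mono := by
    intro i j j' hj hj'
    rw [lt_rectShape_two_iff] at hj'
    rw [pathLabel_le_iff hd hj'.1 (by omega) (pathLabel_le _)]
    exact hj.trans_lt ((pathLabel_le_iff hd hj'.1 hj'.2 (pathLabel_le _)).1 le_rfl)
  row_strict := by
    intro i j j' hj hj' h
    rw [lt_rectShape_two_iff] at hj'
    obtain ⟨k, hk⟩ := Nat.exists_eq_succ_of_ne_zero ((pathLabel_ne_zero_iff hd (i, j')).2 hj')
    have hkn : k < n := by
      have := pathLabel_le (n := n) (d := d) (i, j')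
      omega
    have h1 := (pathLabel_eq_succ_iff hd hkn).1 hk
    have h2 := (pathLabel_eq_succ_iff hd hkn).1 (h.trans hk)
    have := rowEnd_succ hd i hkn
    simp only at h1 h2
    omega
  col_mono := by
    intro i i' j hi hj hj'
    rw [lt_rectShape_two_iff] at hj hj'
    rw [pathLabel_le_iff hd hj.1 hj.2 (pathLabel_le _)]
    have := (pathLabel_le_iff hd hj'.1 hj'.2 (pathLabel_le (i', j))).1 le_rfl
    obtain rfl | ⟨rfl, rfl⟩ : i = i' ∨ (i = 0 ∧ i' = 1) := by omega
    · exact this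
    · exact this.trans_le (rowEnd_one_le _)
  col_strict := by
    intro i i' j hi _ hj' _
    rw [lt_rectShape_two_iff] at hj'
    omega

theorem height_tableauOfPath (hd : IsTableauPath n d) {k : ℕ} (hk : k ≤ n) :
    height (tableauOfPath hd) k = d k := by
  have hn : rowEnd d 0 k ≤ n := (rowEnd_mono hd 0 hk le_rfl).trans (rowEnd_finish hd 0).le
  have hset : {j ∈ range n | (tableauOfPath hd).label (0, j) ≤ k} = range (rowEnd d 0 k) := by
    ext j
    simp only [mem_filter, mem_range]
    constructor
    · rintro ⟨hj, h⟩
      exact (pathLabel_le_iff hd (by omega) hj hk).1 h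
    · intro h
      exact ⟨by omega, (pathLabel_le_iff hd (by omega) (by omega) hk).2 h⟩
  rw [height, rowCount, hset, card_range, rowEnd, if_pos rfl]
  omega

end OfPath

section Compatible

variable {n : ℕ} {d d' w w' : ℕ → ℕ}

/-- The word `w` has a `0` at every down step and no `0` at any up step of `d`, and its zeros
at flat steps precede its nonzero letters at flat steps. -/
structure Compatible (n : ℕ) (d w : ℕ → ℕ) : Prop where
  up : ∀ k < n, d (k + 1) = d k + 1 → w (k + 1) ≠ 0
  down : ∀ k < n, d k = d (k + 1) + 1 → w (k + 1) = 0
  flat : ∀ k l, k < l → l < n → d k = d (k + 1) → d l = d (l + 1) →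
    w (l + 1) = 0 → w (k + 1) = 0

/-- The first place where two paths with a common compatible word can separate is a `1` that is
an up step of one and a flat step of the other; the former then stays above the latter. -/
theorem Compatible.lt_of_separate (hd : IsTableauPath n d) (hd' : IsTableauPath n d')
    (h : Compatible n d w) (h' : Compatible n d' w) {k l : ℕ} (hkl : k < l) (hl : l ≤ n)
    (hw : w (k + 1) ≠ 0) (hflat : d' k = d' (k + 1)) (hlt : d' (k + 1) < d (k + 1)) :
    d' l < d l := by
  induction l, hkl using Nat.le_induction with
  | base => exact hlt
  | succ l hkl ih =>
    have ih := ih (by omega)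
    have s := hd.step l hl
    have s' := hd'.step l hl
    have a := h.up l hl
    have b := h.down l hl
    have a' := h'.up l hl
    have c' := h'.flat k l hkl hl hflat
    by_cases hwl : w (l + 1) = 0
    · have : d' l ≠ d' (l + 1) := fun e => hw (c' e hwl)
      have := mt a' (not_not.2 hwl)
      omega
    · have := mt b hwl
      omega

theorem Compatible.path_unique (hd : IsTableauPath n d) (hd' : IsTableauPath n d')
    (h : Compatible n d w) (h' : Compatible n d' w) {k : ℕ} (hk : k ≤ n) : d k = d' k := by
  induction k with
  | zero => rw [hd.start, hd'.start]
  | succ k ih =>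
    have ih := ih (by omega)
    by_contra hne
    have s := hd.step k hk
    have s' := hd'.step k hk
    have hf := hd.finish
    have hf' := hd'.finish
    by_cases hw : w (k + 1) = 0
    · have := mt (h.up k hk) (not_not.2 hw)
      have := mt (h'.up k hk) (not_not.2 hw)
      omega
    · have := mt (h.down k hk) hw
      have := mt (h'.down k hk) hw
      rcases Nat.lt_or_gt_of_ne hne with hlt | hlt
      · have := Compatible.lt_of_separate hd' hd h' h hk le_rfl hw (by omega) hlt
        omega
      · have := Compatible.lt_of_separate hd hd' h h' hk le_rfl hw (by omega) hlt
        omega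

theorem Words.finite_zeros {m : ℕ} (hw : w ∈ Words n m) : {i | w i = 0}.Finite :=
  (Set.finite_Icc 1 n).subset hw.2.1

theorem Compatible.zeros_subset (hd : IsTableauPath n d) {m : ℕ} (hw : w ∈ Words n m)
    (hw' : w' ∈ Words n m) (h : Compatible n d w) (h' : Compatible n d w') :
    {i | w i = 0} ⊆ {i | w' i = 0} := by
  intro v hv
  by_contra hv'
  simp only [Set.mem_ofPred_eq] at hv hv'
  have hvn := hw.2.1 v hv
  obtain ⟨k, rfl⟩ : ∃ k, v = k + 1 := ⟨v - 1, by omega⟩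
  have hk : k < n := by omega
  have hflat : d k = d (k + 1) := by
    have s := hd.step k hk
    have := mt (h.up k hk) (not_not.2 hv)
    have := mt (h'.down k hk) hv'
    omega
  have hss : {i | w' i = 0} ⊂ {i | w i = 0} := by
    refine ⟨fun u hu => ?_, fun hsub => hv' (hsub hv)⟩
    simp only [Set.mem_ofPred_eq] at hu ⊢
    have hun := hw'.2.1 u hu
    obtain ⟨l, rfl⟩ : ∃ l, u = l + 1 := ⟨u - 1, by omega⟩
    have hl : l < n := by omega
    have s := hd.step l hl
    have hup := mt (h'.up l hl) (not_not.2 hu)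
    by_cases hdown : d l = d (l + 1) + 1
    · exact h.down l hl hdown
    · have hflat' : d l = d (l + 1) := by omega
      rcases lt_trichotomy l k with hlk | rfl | hkl
      · exact h.flat l k hlk hk hflat' hflat hv
      · exact hv
      · exact absurd (h'.flat k l hkl hl hflat hflat' hu) hv'
  have := Set.ncard_lt_ncard hss (Words.finite_zeros hw)
  rw [hw.2.2, hw'.2.2] at this
  exact lt_irrefl m this

theorem Compatible.word_unique (hd : IsTableauPath n d) {m : ℕ} (hw : w ∈ Words n m)
    (hw' : w' ∈ Words n m) (h : Compatible n d w) (h' : Compatible n d w') : w = w' := by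
  funext i
  have h1 : w i = 0 → w' i = 0 := fun e => Compatible.zeros_subset hd hw hw' h h' e
  have h2 : w' i = 0 → w i = 0 := fun e => Compatible.zeros_subset hd hw' hw h' h e
  have := hw.1 i
  have := hw'.1 i
  omega

/-- The number of letters `1` among the first `i` that are not matched by a later `0` among
the first `i`. -/
def openCount (w : ℕ → ℕ) : ℕ → ℕ
  | 0 => 0
  | i + 1 => if w (i + 1) = 0 then openCount w i - 1 else openCount w i + 1

/-- The number of letters `0` among the last `m` of `n` that are not matched by an earlier `1`
among the last `m`. -/
def closeCount (n : ℕ) (w : ℕ → ℕ) : ℕ → ℕ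
  | 0 => 0
  | m + 1 => if w (n - m) = 0 then closeCount n w m + 1 else closeCount n w m - 1

/-- Matching each `1` with a later `0` as parentheses, the height after `i` letters is the number
of matched pairs that are open there. -/
theorem exists_compatible_path (n : ℕ) (w : ℕ → ℕ) :
    ∃ d, IsTableauPath n d ∧ Compatible n d w := by
  set p := openCount w
  set s := fun i => closeCount n w (n - i) with hs
  have p0 : p 0 = 0 := rfl
  have sn : s n = 0 := by simp [hs, closeCount]
  have pstep : ∀ i, p (i + 1) = if w (i + 1) = 0 then p i - 1 else p i + 1 := fun i => rfl
  have sstep : ∀ i < n, s i = if w (i + 1) = 0 then s (i + 1) + 1 else s (i + 1) - 1 := by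
    intro i hi
    obtain ⟨m, rfl⟩ : ∃ m, n = i + 1 + m := ⟨n - (i + 1), by omega⟩
    have e1 : i + 1 + m - i = m + 1 := by omega
    have e2 : i + 1 + m - (i + 1) = m := by omega
    have e3 : i + 1 + m - m = i + 1 := by omega
    simp only [hs, e1, e2, closeCount, e3]
  have persist : ∀ i j, i ≤ j → j ≤ n → s i < p i → s j < p j := by
    intro i j hij hj hi
    induction j, hij using Nat.le_induction with
    | base => exact hi
    | succ j _ ih =>
      have ih := ih (by omega)
      have h1 := pstep j
      have h2 := sstep j hj
      split_ifs at h1 h2 <;> omega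
  clear_value p s
  refine ⟨fun i => min (p i) (s i), ⟨by simp [p0], by simp [sn], ?_⟩, ⟨?_, ?_, ?_⟩⟩
  · intro k hk
    have h1 := pstep k
    have h2 := sstep k hk
    split_ifs at h1 h2 <;> omega
  · intro k hk h hw
    have h1 := pstep k
    have h2 := sstep k hk
    simp only [hw, if_true] at h h1 h2
    omega
  · intro k hk h
    have h1 := pstep k
    have h2 := sstep k hk
    by_contra hw
    simp only [hw, if_false] at h h1 h2
    omega
  · intro k l hkl hl hk hl' hwl
    by_contra hwk
    have h1 := pstep k
    have h2 := sstep k (by omega)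
    have h3 := pstep l
    have h4 := sstep l hl
    have h5 := persist (k + 1) l hkl hl.le
    simp only [hwk, hwl, if_true, if_false] at hk hl' h1 h2 h3 h4
    omega

end Compatible

section Word

variable {n : ℕ} (D : DT2 n)

/-- The labels of the bottom horizontal dominoes, as a finset. -/
noncomputable def bhFinset : Finset ℕ := {v ∈ range (n + 1) | v ∈ bhSet n D}

/-- The labels of the vertical dominoes, as a finset. -/
noncomputable def vertFinset : Finset ℕ := {v ∈ range (n + 1) | v ∈ vertSet n D}

theorem coe_bhFinset : (bhFinset D : Set ℕ) = bhSet n D := by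
  ext v
  simp only [bhFinset, coe_filter, mem_range, Set.mem_ofPred_eq, and_iff_right_iff_imp]
  intro h
  obtain ⟨k, hk, rfl, -⟩ := (mem_bhSet_iff D v).1 h
  omega

theorem coe_vertFinset : (vertFinset D : Set ℕ) = vertSet n D := by
  ext v
  simp only [vertFinset, coe_filter, mem_range, Set.mem_ofPred_eq, and_iff_right_iff_imp]
  intro h
  obtain ⟨k, hk, rfl, -⟩ := (mem_vertSet_iff D v).1 h
  omega

theorem two_mul_card_bhFinset_add : 2 * #(bhFinset D) + #(vertFinset D) = n := by
  have key : ∀ k ≤ n, 2 * #{v ∈ range (k + 1) | v ∈ bhSet n D} +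
      #{v ∈ range (k + 1) | v ∈ vertSet n D} + height D k = k := by
    intro k hk
    induction k with
    | zero =>
      have h1 : 0 ∉ bhSet n D := by simp [mem_bhSet_iff]
      have h2 : 0 ∉ vertSet n D := by simp [mem_vertSet_iff]
      simp [filter_singleton, h1, h2, (isTableauPath_height D).start]
    | succ k ih =>
      have ih := ih (by omega)
      have h1 : k + 1 ∈ bhSet n D ↔ _ := isBottomHorizontal_succ_iff D hk
      have h2 : k + 1 ∈ vertSet n D ↔ _ := isVertical_succ_iff D hk
      have s := (isTableauPath_height D).step k hk
      rw [range_add_one (n := k + 1), filter_insert, filter_insert]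
      simp only [h1, h2]
      split_ifs <;> (try simp only [card_insert_of_notMem, mem_filter, mem_range, lt_irrefl,
        false_and, not_false_iff]) <;> omega
  have := key n le_rfl
  rwa [(isTableauPath_height D).finish] at this

theorem mem_Phi_iff (v : ℕ) :
    v ∈ Phi n D ↔ v ∈ bhFinset D ∨
      (v ∈ vertFinset D ∧ #{u ∈ vertFinset D | u ≤ v} ≤ n / 2 - #(bhFinset D)) := by
  have hset : vertSet n D ∩ Set.Iic v = ({u ∈ vertFinset D | u ≤ v} : Finset ℕ) := by
    rw [← coe_vertFinset]
    ext u
    simp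
  rw [Phi, Set.mem_union, Set.mem_ofPred_eq, hset, ← coe_bhFinset, ← coe_vertFinset,
    Set.ncard_coe_finset, Set.ncard_coe_finset, mem_coe, mem_coe]

theorem ncard_Phi : (Phi n D).ncard = n / 2 := by
  have hset : Phi n D = (bhFinset D ∪ {v ∈ vertFinset D |
      #{u ∈ vertFinset D | u ≤ v} ≤ n / 2 - #(bhFinset D)} : Finset ℕ) := by
    ext v
    simp [mem_Phi_iff]
  have hdisj : Disjoint (bhFinset D) {v ∈ vertFinset D |
      #{u ∈ vertFinset D | u ≤ v} ≤ n / 2 - #(bhFinset D)} := by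
    rw [disjoint_left]
    intro v hv hv'
    rw [← mem_coe, coe_bhFinset, mem_bhSet_iff] at hv
    have hv' := (mem_filter.1 hv').1
    rw [← mem_coe, coe_vertFinset, mem_vertSet_iff] at hv'
    obtain ⟨k, -, rfl, h⟩ := hv
    obtain ⟨l, -, hl, h'⟩ := hv'
    obtain rfl : k = l := by omega
    omega
  rw [hset, Set.ncard_coe_finset, card_union_of_disjoint hdisj, card_filter_rank_le]
  have := two_mul_card_bhFinset_add D
  omega

theorem wordOf_eq_zero_iff (v : ℕ) : wordOf n D v = 0 ↔ v ∈ Phi n D := by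
  unfold wordOf
  split_ifs with h <;> simp [h]

theorem compatible_wordOf : Compatible n (height D) (wordOf n D) where
  up k hk h := by
    rw [Ne, wordOf_eq_zero_iff]
    rintro (hb | ⟨hv, -⟩)
    · have := (isBottomHorizontal_succ_iff D hk).1 hb
      omega
    · have := (isVertical_succ_iff D hk).1 hv
      omega
  down k hk h := by
    rw [wordOf_eq_zero_iff]
    exact Or.inl ((isBottomHorizontal_succ_iff D hk).2 h)
  flat k l hkl hl hk hl' := by
    rw [wordOf_eq_zero_iff, wordOf_eq_zero_iff, mem_Phi_iff, mem_Phi_iff]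
    rintro (hb | ⟨-, hr⟩)
    · rw [← mem_coe, coe_bhFinset] at hb
      have := (isBottomHorizontal_succ_iff D hl).1 hb
      omega
    · refine Or.inr ⟨?_, le_trans (card_le_card ?_) hr⟩
      · rw [← mem_coe, coe_vertFinset]
        exact (isVertical_succ_iff D (by omega)).2 hk
      · intro u hu
        simp only [mem_filter] at hu ⊢
        exact ⟨hu.1, by omega⟩

theorem wordOf_mem_Words : wordOf n D ∈ Words n (n / 2) := by
  refine ⟨fun i => ?_, fun i hi => ?_, ?_⟩
  · unfold wordOf
    split_ifs <;> omega
  · rw [wordOf_eq_zero_iff] at hi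
    rcases hi with h | ⟨h, -⟩
    · obtain ⟨k, hk, rfl, -⟩ := (mem_bhSet_iff D i).1 h
      omega
    · obtain ⟨k, hk, rfl, -⟩ := (mem_vertSet_iff D i).1 h
      omega
  · simp only [wordOf_eq_zero_iff]
    exact ncard_Phi D

theorem DesD_eq_DesW_wordOf : DesD n D = DesW (wordOf n D) := by
  have hc := compatible_wordOf D
  have hd := isTableauPath_height D
  have hw := wordOf_mem_Words D
  ext i
  simp only [DesD, DesW, Set.mem_ofPred_eq]
  constructor
  · rintro ⟨hi, hin, h⟩
    obtain ⟨k, rfl⟩ : ∃ k, i = k + 1 := ⟨i - 1, by omega⟩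
    rw [neRow_succ D (by omega), neRow_succ D (by omega)] at h
    split_ifs at h with h1 h2 h2
    all_goals try omega
    have s := hd.step k (by omega)
    have := hc.up k (by omega) (by omega)
    have := hw.1 (k + 1)
    exact ⟨hi, by omega, hc.down (k + 1) (by omega) h2⟩
  · rintro ⟨hi, h1, h0⟩
    have hin := (hw.2.1 _ h0).2
    obtain ⟨k, rfl⟩ : ∃ k, i = k + 1 := ⟨i - 1, by omega⟩
    refine ⟨hi, hin, ?_⟩
    have s := hd.step k (by omega)
    have s' := hd.step (k + 1) (by omega)
    have a := mt (hc.down k (by omega)) (by omega)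
    have b := mt (hc.up (k + 1) (by omega)) (not_not.2 h0)
    have c : height D k = height D (k + 1) →
        height D (k + 1) ≠ height D (k + 1 + 1) := by
      intro e e'
      have := hc.flat k (k + 1) (by omega) (by omega) e e' h0
      omega
    rw [neRow_succ D (by omega), neRow_succ D (by omega), if_neg a, if_pos (by omega)]
    exact one_pos

end Word

/-- For `n ≥ 1`, the map `D ↦ (a_i)` with `a_i = 0` iff `i ∈ Φ(D)` is a
bijection from `DT((n,n))` onto the binary words of length `n` with `⌊n/2⌋` zeros, and it
preserves descent sets. -/
theorem dt_two_row_word_bijection_preserves_descents (n : ℕ) (hn : 1 ≤ n) :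
    Set.BijOn (wordOf n) (Set.univ : Set (DT2 n)) (Words n (n / 2)) ∧
    ∀ D : DT2 n, DesD n D = DesW (wordOf n D) := by
  refine ⟨⟨fun D _ => wordOf_mem_Words D, ?_, ?_⟩, DesD_eq_DesW_wordOf⟩
  · intro D _ D' _ h
    have hc := compatible_wordOf D
    rw [h] at hc
    exact eq_of_height_eq fun k hk => Compatible.path_unique (isTableauPath_height D)
      (isTableauPath_height D') hc (compatible_wordOf D') hk
  · intro w hw
    obtain ⟨d, hd, hc⟩ := exists_compatible_path n w
    refine ⟨tableauOfPath hd, trivial, ?_⟩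
    have hheight : ∀ k ≤ n, height (tableauOfPath hd) k = d k :=
      fun k hk => height_tableauOfPath hd hk
    refine Compatible.word_unique (isTableauPath_height _) (wordOf_mem_Words _) hw
      (compatible_wordOf _) ⟨fun k hk => ?_, fun k hk => ?_, fun k l hkl hl => ?_⟩
    · rw [hheight k hk.le, hheight (k + 1) hk]
      exact hc.up k hk
    · rw [hheight k hk.le, hheight (k + 1) hk]
      exact hc.down k hk
    · rw [hheight k (by omega), hheight (k + 1) (by omega), hheight l hl.le,
        hheight (l + 1) hl]
      exact hc.flat k l hkl hl
end

section
/- Let D be a domino tableau of shape (n,n), S = Φ(D), and S' = {(s mod n) + 1 : s ∈ S} the image of S under the cyclic shift by 1 on {1,…,n} (i.e., s ↦ s+1 for s < n and n ↦ 1). Let D' = Φ^{-1}(S'), let H and V be the sets of labels in S belonging to bottom horizontal and to vertical dominoes of D respectively, and let H' and V' be the analogous sets for D' and S'. Fix s ∈ S with s < n. Then: (a) if s ∈ H, then s+1 ∈ H'; and (b) if s ∈ V, then s+1 ∈ H' if and only if V contains no element smaller than s and n ∉ S, and otherwise s+1 ∈ V'. -/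
open scoped Classical

/-- The cyclic shift by `1` on subsets of `{1, …, n}`: `s ↦ (s mod n) + 1`, i.e.
`s ↦ s + 1` for `s < n` and `n ↦ 1`. -/
def shiftSet (n : ℕ) (S : Set ℕ) : Set ℕ := (fun s => s % n + 1) '' S

namespace DominoTableau

variable {n : ℕ}

lemma label_ne_zero_iff (D : DT2 n) (i j : ℕ) : D.label (i, j) ≠ 0 ↔ i < 2 ∧ j < n := by
  rw [D.support]
  by_cases hi : i < 2 <;> simp [rectShape, hi]

lemma two_cells (D : DT2 n) {c d e : ℕ × ℕ} (h0 : D.label c ≠ 0)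
    (hd : D.label d = D.label c) (he : D.label e = D.label c) : c = d ∨ c = e ∨ d = e := by
  obtain ⟨x, y, -, -, hxy⟩ :=
    D.fiber_domino (D.label c) (Nat.pos_of_ne_zero h0) (D.bounded c)
  have h1 := (hxy c).1 rfl
  have h2 := (hxy d).1 hd
  have h3 := (hxy e).1 he
  grind

lemma label_mono (D : DT2 n) {i j j' : ℕ} (hi : i < 2) (hj : j ≤ j') (hj' : j' < n) :
    D.label (i, j) ≤ D.label (i, j') :=
  D.row_mono i j j' hj (by simpa [rectShape, hi] using hj')

lemma label_top_le_bottom (D : DT2 n) {j : ℕ} (hj : j < n) :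
    D.label (0, j) ≤ D.label (1, j) :=
  D.col_mono 0 1 j zero_le_one (by simpa [rectShape] using hj) (by simpa [rectShape] using hj)

lemma eq_succ_of_label_eq (D : DT2 n) {i j j' : ℕ} (hi : i < 2) (hj : j < j') (hj' : j' < n)
    (h : D.label (i, j) = D.label (i, j')) : j' = j + 1 :=
  D.row_strict i j j' hj (by simpa [rectShape, hi] using hj') h

/-- The domino covering a given cell is vertical or horizontal in the row of that cell. -/
lemma vertical_or_horizontal (D : DT2 n) {i j : ℕ} (hi : i < 2) (hj : j < n) :
    D.label (0, j) = D.label (1, j) ∨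
      (∃ l, l + 1 < n ∧ D.label (i, l) = D.label (i, j) ∧ D.label (i, l + 1) = D.label (i, j)) := by
  have h0 := (D.label_ne_zero_iff i j).2 ⟨hi, hj⟩
  obtain ⟨⟨x1, x2⟩, ⟨y1, y2⟩, -, hadj, hxy⟩ :=
    D.fiber_domino (D.label (i, j)) (Nat.pos_of_ne_zero h0) (D.bounded _)
  have hx := (hxy (x1, x2)).2 (.inl rfl)
  have hy := (hxy (y1, y2)).2 (.inr rfl)
  have hx' := (D.label_ne_zero_iff x1 x2).1 (hx ▸ h0)
  have hy' := (D.label_ne_zero_iff y1 y2).1 (hy ▸ h0)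
  have hc := (hxy (i, j)).1 rfl
  simp only [DominoAdj, Prod.mk.injEq] at hadj hc
  rcases hadj with ⟨rfl, hh | hh⟩ | ⟨rfl, hv⟩
  · have : x1 = i := by grind
    subst this
    exact .inr ⟨x2, by omega, hx, by rw [hh, hy]⟩
  · have : x1 = i := by grind
    subst this
    exact .inr ⟨y2, by omega, hy, by rw [hh, hx]⟩
  · left
    have : x2 = j := by grind
    subst this
    rcases hv with hv | hv
    · obtain ⟨rfl, rfl⟩ : x1 = 0 ∧ y1 = 1 := by omega
      rw [hx, hy]
    · obtain ⟨rfl, rfl⟩ : x1 = 1 ∧ y1 = 0 := by omega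
      rw [hx, hy]

lemma notMem_bhSet_of_mem_vertSet (D : DT2 n) {k : ℕ} (hv : k ∈ vertSet n D) :
    k ∉ bhSet n D := by
  rintro ⟨j, hj, h1, h2⟩
  obtain ⟨l, hl, h3, h4⟩ := hv
  have h0 := (D.label_ne_zero_iff 0 l).2 ⟨by omega, hl⟩
  have := D.two_cells h0 (h1.trans h3.symm) (h2.trans h3.symm)
  simp at this

/-- A label that is neither vertical nor bottom horizontal is top horizontal. -/
lemma exists_top_horizontal (D : DT2 n) {k : ℕ} (hk : 1 ≤ k) (hkn : k ≤ n)
    (hv : k ∉ vertSet n D) (hb : k ∉ bhSet n D) :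
    ∃ j, j + 1 < n ∧ D.label (0, j) = k ∧ D.label (0, j + 1) = k := by
  obtain ⟨⟨i, j⟩, _, -, -, hxy⟩ := D.fiber_domino k hk hkn
  have hc := (hxy (i, j)).2 (.inl rfl)
  obtain ⟨hi, hj⟩ := (D.label_ne_zero_iff i j).1 (by omega)
  rcases D.vertical_or_horizontal hi hj with h | ⟨l, hl, h1, h2⟩
  · refine absurd ⟨j, hj, ?_, ?_⟩ hv <;> interval_cases i <;> omega
  · interval_cases i
    · exact ⟨l, hl, h1.trans hc, h2.trans hc⟩
    · exact absurd ⟨l, hl, h1.trans hc, h2.trans hc⟩ hb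

/-- The bottom label in the first column of a top horizontal domino is bottom horizontal, and it
lies between the top label and any later vertical label. -/
lemma bottom_of_top_horizontal (D : DT2 n) {j : ℕ} (hj : j + 1 < n)
    (h : D.label (0, j) = D.label (0, j + 1)) :
    D.label (1, j) ∈ bhSet n D ∧ D.label (0, j) < D.label (1, j) ∧
      ∀ v ∈ vertSet n D, D.label (0, j) < v → D.label (1, j) < v := by
  have hne : D.label (0, j) ≠ D.label (1, j) := by
    intro hc
    have := D.two_cells ((D.label_ne_zero_iff 0 j).2 ⟨by omega, by omega⟩) h.symm hc.symm
    simp at this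
  have hb : D.label (1, j) ∈ bhSet n D :=
    (D.vertical_or_horizontal one_lt_two (by omega)).resolve_left hne
  refine ⟨hb, lt_of_le_of_ne (D.label_top_le_bottom (by omega)) hne, fun v hv hlt => ?_⟩
  have hvb : D.label (1, j) ≠ v := fun hc => D.notMem_bhSet_of_mem_vertSet hv (hc ▸ hb)
  obtain ⟨l, hl, h1, h2⟩ := hv
  have hjl : j ≤ l := by
    by_contra hc
    have := D.label_mono (i := 0) two_pos (show l ≤ j by omega) (by omega)
    omega
  have := D.label_mono one_lt_two hjl hl
  omega

/-- The top label in the first column of a bottom horizontal domino is top horizontal, and it lies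
between any earlier vertical label and the bottom label. -/
lemma top_of_bottom_horizontal (D : DT2 n) {j : ℕ} (hj : j + 1 < n)
    (h : D.label (1, j) = D.label (1, j + 1)) :
    D.label (0, j) ∉ vertSet n D ∧ D.label (0, j) ∉ bhSet n D ∧
      D.label (0, j) ≤ D.label (1, j) ∧
      ∀ v ∈ vertSet n D, v < D.label (1, j) → v < D.label (0, j) := by
  have h0 := (D.label_ne_zero_iff 0 j).2 ⟨by omega, by omega⟩
  have hnv : D.label (0, j) ∉ vertSet n D := by
    rintro ⟨l, hl, h1, h2⟩
    have h3 := D.two_cells h0 h1 h2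
    simp only [Prod.mk.injEq, zero_ne_one, false_and, true_and, or_false] at h3
    subst h3
    have h4 := D.two_cells h0 h2 (h.symm.trans h2)
    simp at h4
  have hnb : D.label (0, j) ∉ bhSet n D := by
    rintro ⟨l, hl, h1, h2⟩
    have h3 := D.two_cells h0 h1 h2
    simp at h3
  refine ⟨hnv, hnb, D.label_top_le_bottom (by omega), fun v hv hlt => ?_⟩
  have hvne : D.label (0, j) ≠ v := fun hc => hnv (hc ▸ hv)
  obtain ⟨l, hl, h1, h2⟩ := hv
  have hlj : l ≤ j := by
    by_contra hc
    have := D.label_mono one_lt_two (show j ≤ l by omega) hl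
    omega
  have := D.label_mono (i := 0) two_pos hlj (by omega)
  omega

lemma mem_Icc_of_mem_Phi (D : DT2 n) {k : ℕ} (hk : k ∈ Phi n D) : 1 ≤ k ∧ k ≤ n := by
  have key (j : ℕ) (hj : j < n) (h : D.label (1, j) = k) : 1 ≤ k ∧ k ≤ n := by
    have h0 := (D.label_ne_zero_iff 1 j).2 ⟨one_lt_two, hj⟩
    have := D.bounded (1, j)
    omega
  rcases hk with ⟨j, hj, h, -⟩ | ⟨⟨j, hj, -, h⟩, -⟩
  · exact key j (by omega) h
  · exact key j hj h

lemma mem_vertSet_of_mem_Phi_diff (D : DT2 n) {k : ℕ} (hk : k ∈ Phi n D \ bhSet n D) :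
    k ∈ vertSet n D :=
  (hk.1.resolve_left hk.2).1

lemma mem_Phi_of_vertSet_of_le (D : DT2 n) {u v : ℕ} (hu : u ∈ vertSet n D)
    (hv : v ∈ Phi n D \ bhSet n D) (huv : u ≤ v) : u ∈ Phi n D := by
  refine .inr ⟨hu, le_trans ?_ (hv.1.resolve_left hv.2).2⟩
  exact Set.ncard_le_ncard (Set.inter_subset_inter_right _ (Set.Iic_subset_Iic.2 huv))
    ((Set.finite_Iic v).inter_of_right _)

end DominoTableau

/-- The height after `k` steps of the lattice path that goes down at the positions in `S` and up at
the other positions. -/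
noncomputable def pathHeight (S : Set ℕ) (k : ℕ) : ℤ :=
  ∑ i ∈ Finset.range k, if i + 1 ∈ S then -1 else 1

lemma pathHeight_succ (S : Set ℕ) (k : ℕ) :
    pathHeight S (k + 1) = pathHeight S k + if k + 1 ∈ S then -1 else 1 :=
  Finset.sum_range_succ _ _

lemma pathHeight_zero (S : Set ℕ) : pathHeight S 0 = 0 := rfl

lemma pathHeight_eq_add_card_sub_card (S : Set ℕ) {j k : ℕ} (hjk : j ≤ k) :
    pathHeight S k = pathHeight S j + ((Finset.Ioc j k).filter (· ∉ S)).card -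
      ((Finset.Ioc j k).filter (· ∈ S)).card := by
  induction k, hjk using Nat.le_induction with
  | base => simp
  | succ k hjk ih =>
    rw [pathHeight_succ, ih, ← Finset.insert_Ioc_right_eq_Ioc_add_one hjk]
    by_cases h : k + 1 ∈ S <;> simp [Finset.filter_insert, h] <;> ring

namespace DominoTableau

variable {n : ℕ}

/-- From the start, or from a selected vertical label, the path does not go down before the next
selected vertical label. -/
lemma pathHeight_le_of_no_vertical (D : DT2 n) {j k : ℕ} (hjk : j ≤ k)
    (hj : j = 0 ∨ j ∈ vertSet n D)
    (hno : ∀ i, j < i → i ≤ k → i ∈ Phi n D → i ∈ bhSet n D) :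
    pathHeight (Phi n D) j ≤ pathHeight (Phi n D) k := by
  have hcard : ((Finset.Ioc j k).filter (· ∈ Phi n D)).card ≤
      ((Finset.Ioc j k).filter (· ∉ Phi n D)).card := by
    refine Finset.card_le_card_of_forall_subsingleton
      (fun b t => ∃ l, l + 1 < n ∧ D.label (1, l) = b ∧ D.label (1, l + 1) = b ∧
        D.label (0, l) = t) ?_ ?_
    · intro b hb
      simp only [Finset.mem_filter, Finset.mem_Ioc] at hb
      obtain ⟨l, hl, h1, h2⟩ := hno b hb.1.1 hb.1.2 hb.2
      obtain ⟨hnv, hnb, hle, hlt⟩ := D.top_of_bottom_horizontal hl (h1.trans h2.symm)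
      have h0 := (D.label_ne_zero_iff 0 l).2 ⟨by omega, by omega⟩
      refine ⟨D.label (0, l), ?_, l, hl, h1, h2, rfl⟩
      simp only [Finset.mem_filter, Finset.mem_Ioc]
      refine ⟨⟨?_, by omega⟩, fun h => h.elim hnb fun h => hnv h.1⟩
      rcases hj with rfl | hj
      · omega
      · exact hlt j hj (by omega)
    · rintro t - b ⟨-, l, hl, h1, h2, h3⟩ b' ⟨-, l', hl', h1', h2', h3'⟩
      rcases lt_trichotomy l l' with hll | rfl | hll
      · have := D.eq_succ_of_label_eq (i := 0) two_pos hll (by omega) (h3.trans h3'.symm)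
        subst this
        exact h2.symm.trans h1'
      · exact h1.symm.trans h1'
      · have := D.eq_succ_of_label_eq (i := 0) two_pos hll (by omega) (h3'.trans h3.symm)
        subst this
        exact h1.symm.trans h2'
  rw [pathHeight_eq_add_card_sub_card _ hjk]
  omega

/-- The path reaches a new strict minimum at each selected vertical label. -/
lemma pathHeight_lt_of_selected_vertical (D : DT2 n) {j v : ℕ} (hjv : j < v)
    (hv : v ∈ Phi n D \ bhSet n D) :
    pathHeight (Phi n D) v < pathHeight (Phi n D) j := by
  have hvn := (D.mem_Icc_of_mem_Phi hv.1).2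
  have hvv := D.mem_vertSet_of_mem_Phi_diff hv
  have hmem : v ∈ (Finset.Ioc j v).filter (· ∈ Phi n D) := by
    simpa [hjv] using hv.1
  have hcard : ((Finset.Ioc j v).filter (· ∉ Phi n D)).card ≤
      (((Finset.Ioc j v).filter (· ∈ Phi n D)).erase v).card := by
    refine Finset.card_le_card_of_forall_subsingleton
      (fun t b => ∃ l, l + 1 < n ∧ D.label (0, l) = t ∧ D.label (0, l + 1) = t ∧
        D.label (1, l) = b) ?_ ?_
    · intro t ht
      simp only [Finset.mem_filter, Finset.mem_Ioc] at ht
      have htv : t ∉ vertSet n D := fun h => ht.2 (D.mem_Phi_of_vertSet_of_le h hv ht.1.2)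
      have htlt : t < v := lt_of_le_of_ne ht.1.2 fun h => ht.2 (h ▸ hv.1)
      obtain ⟨l, hl, h1, h2⟩ :=
        D.exists_top_horizontal (by omega) (by omega) htv fun h => ht.2 (.inl h)
      obtain ⟨hb, hlt, hltv⟩ := D.bottom_of_top_horizontal hl (h1.trans h2.symm)
      have := hltv v hvv (by omega)
      refine ⟨D.label (1, l), ?_, l, hl, h1, h2, rfl⟩
      simp only [Finset.mem_erase, Finset.mem_filter, Finset.mem_Ioc]
      exact ⟨by omega, ⟨by omega, by omega⟩, .inl hb⟩
    · rintro b - t ⟨-, l, hl, h1, h2, h3⟩ t' ⟨-, l', hl', h1', h2', h3'⟩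
      rcases lt_trichotomy l l' with hll | rfl | hll
      · have := D.eq_succ_of_label_eq one_lt_two hll (by omega) (h3.trans h3'.symm)
        subst this
        exact h2.symm.trans h1'
      · exact h1.symm.trans h1'
      · have := D.eq_succ_of_label_eq one_lt_two hll (by omega) (h3'.trans h3.symm)
        subst this
        exact h1.symm.trans h2'
  rw [Finset.card_erase_of_mem hmem] at hcard
  have := Finset.card_pos.2 ⟨v, hmem⟩
  rw [pathHeight_eq_add_card_sub_card _ hjv.le]
  omega

lemma mem_bhSet_iff_exists_pathHeight_le (D : DT2 n) {k : ℕ} (hk : k ∈ Phi n D) :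
    k ∈ bhSet n D ↔ ∃ j < k, pathHeight (Phi n D) j ≤ pathHeight (Phi n D) k := by
  constructor
  · intro hb
    have hk1 := (D.mem_Icc_of_mem_Phi hk).1
    let j := Nat.findGreatest (fun i => i ∈ Phi n D \ bhSet n D) k
    have hjk : j ≤ k := Nat.findGreatest_le k
    have hj : j = 0 ∨ j ∈ Phi n D \ bhSet n D :=
      or_iff_not_imp_left.2 fun h => Nat.findGreatest_of_ne_zero rfl h
    have hne : j ≠ k := by
      intro h
      rcases hj with h0 | hj
      · omega
      · exact hj.2 (h ▸ hb)
    refine ⟨j, by omega, D.pathHeight_le_of_no_vertical hjk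
      (hj.imp_right D.mem_vertSet_of_mem_Phi_diff) fun i hji hik hi => ?_⟩
    by_contra hib
    exact Nat.findGreatest_is_greatest hji hik ⟨hi, hib⟩
  · rintro ⟨j, hjk, hle⟩
    by_contra hb
    exact absurd (D.pathHeight_lt_of_selected_vertical hjk ⟨hk, hb⟩) (not_lt.2 hle)

/-- The first selected vertical label is the one where the path first reaches height `-1`. -/
lemma no_smaller_vertical_iff (D : DT2 n) {s : ℕ} (hs : s ∈ Phi n D \ bhSet n D) :
    (Phi n D \ bhSet n D) ∩ Set.Iio s = ∅ ↔ -1 ≤ pathHeight (Phi n D) s := by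
  have hs1 := (D.mem_Icc_of_mem_Phi hs.1).1
  constructor
  · intro h
    obtain ⟨r, rfl⟩ : ∃ r, s = r + 1 := ⟨s - 1, by omega⟩
    have h0 := D.pathHeight_le_of_no_vertical (Nat.zero_le r) (.inl rfl) fun i _ hir hi => by
      by_contra hib
      exact (h ▸ ⟨⟨hi, hib⟩, Nat.lt_succ_of_le hir⟩ : i ∈ (∅ : Set ℕ))
    rw [pathHeight_zero] at h0
    rw [pathHeight_succ, if_pos hs.1]
    omega
  · intro h
    refine Set.eq_empty_of_forall_notMem fun v ⟨hv, hvs⟩ => ?_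
    have h1 := D.pathHeight_lt_of_selected_vertical hvs hs
    have h2 := D.pathHeight_lt_of_selected_vertical (D.mem_Icc_of_mem_Phi hv.1).1 hv
    rw [pathHeight_zero] at h2
    omega

end DominoTableau

lemma succ_mem_shiftSet {n : ℕ} {S : Set ℕ} (hS : ∀ k ∈ S, 1 ≤ k ∧ k ≤ n) {i : ℕ} (hi : 1 ≤ i)
    (hin : i < n) : i + 1 ∈ shiftSet n S ↔ i ∈ S := by
  constructor
  · rintro ⟨t, ht, hti⟩
    obtain ⟨h1, h2⟩ := hS t ht
    simp only [Nat.add_right_cancel_iff] at hti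
    rcases h2.eq_or_lt with rfl | h2
    · rw [Nat.mod_self] at hti
      omega
    · rw [Nat.mod_eq_of_lt h2] at hti
      exact hti ▸ ht
  · exact fun h => ⟨i, h, by simp [Nat.mod_eq_of_lt hin]⟩

lemma one_mem_shiftSet {n : ℕ} {S : Set ℕ} (hS : ∀ k ∈ S, 1 ≤ k ∧ k ≤ n) :
    1 ∈ shiftSet n S ↔ n ∈ S := by
  constructor
  · rintro ⟨t, ht, hti⟩
    obtain ⟨h1, h2⟩ := hS t ht
    simp only [Nat.add_eq_right] at hti
    rcases h2.eq_or_lt with rfl | h2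
    · exact ht
    · rw [Nat.mod_eq_of_lt h2] at hti
      omega
  · exact fun h => ⟨n, h, by simp⟩

lemma pathHeight_shiftSet {n : ℕ} {S : Set ℕ} (hS : ∀ k ∈ S, 1 ≤ k ∧ k ≤ n) {k : ℕ} (hk : k < n) :
    pathHeight (shiftSet n S) (k + 1) = pathHeight S k + if n ∈ S then -1 else 1 := by
  induction k with
  | zero => simp [pathHeight_succ, pathHeight_zero, one_mem_shiftSet hS]
  | succ k ih =>
    rw [pathHeight_succ, ih (by omega), pathHeight_succ S]
    simp only [succ_mem_shiftSet hS (Nat.succ_pos k) hk]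
    ring

/-- Let `S = Φ(D)`, `S' = {(s mod n) + 1 : s ∈ S}` its cyclic shift,
and `D' = Φ⁻¹(S')` (i.e. `Φ(D') = S'`); let `H, V` (resp. `H', V'`) be the bottom
horizontal and vertical label sets of `S` (resp. `S'`).  Fix `s ∈ S` with `s < n`.  Then:
(a) if `s ∈ H` then `s + 1 ∈ H'`; and (b) if `s ∈ V` then `s + 1 ∈ H'` iff `V` contains
no element smaller than `s` and `n ∉ S`, and otherwise `s + 1 ∈ V'`. -/
theorem dt_two_row_shift_H_stays_V_rarely_moves (n : ℕ) (D D' : DT2 n)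
    (h : Phi n D' = shiftSet n (Phi n D)) (s : ℕ) (hs : s ∈ Phi n D) (hsn : s < n) :
    (s ∈ bhSet n D → s + 1 ∈ bhSet n D') ∧
    (s ∈ Phi n D \ bhSet n D →
      ((s + 1 ∈ bhSet n D' ↔
          ((Phi n D \ bhSet n D) ∩ Set.Iio s = ∅ ∧ n ∉ Phi n D)) ∧
       (¬(((Phi n D \ bhSet n D) ∩ Set.Iio s = ∅) ∧ n ∉ Phi n D) →
          s + 1 ∈ Phi n D' \ bhSet n D'))) := by
  have hS : ∀ k ∈ Phi n D, 1 ≤ k ∧ k ≤ n := fun k hk => D.mem_Icc_of_mem_Phi hk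
  have hs1 := (hS s hs).1
  have hs' : s + 1 ∈ Phi n D' := h ▸ (succ_mem_shiftSet hS hs1 hsn).2 hs
  have hheight {k : ℕ} (hk : k < n) : pathHeight (Phi n D') (k + 1) =
      pathHeight (Phi n D) k + if n ∈ Phi n D then -1 else 1 := by
    rw [h, pathHeight_shiftSet hS hk]
  have key : s ∈ Phi n D \ bhSet n D → (s + 1 ∈ bhSet n D' ↔
      ((Phi n D \ bhSet n D) ∩ Set.Iio s = ∅ ∧ n ∉ Phi n D)) := by
    intro hsV
    rw [D'.mem_bhSet_iff_exists_pathHeight_le hs', D.no_smaller_vertical_iff hsV, hheight hsn]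
    constructor
    · rintro ⟨j, hj, hle⟩
      cases j with
      | zero =>
        have hneg := D.pathHeight_lt_of_selected_vertical hs1 hsV
        rw [pathHeight_zero] at hle hneg
        split_ifs at hle with hn
        · omega
        · exact ⟨by omega, hn⟩
      | succ j =>
        rw [hheight (by omega)] at hle
        have := D.pathHeight_lt_of_selected_vertical (show j < s by omega) hsV
        omega
    · rintro ⟨hle, hn⟩
      refine ⟨0, by omega, ?_⟩
      rw [if_neg hn, pathHeight_zero]
      omega
  refine ⟨fun hb => ?_, fun hsV => ⟨key hsV, fun hc => ⟨hs', fun hb => hc ((key hsV).1 hb)⟩⟩⟩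
  obtain ⟨j, hj, hle⟩ := (D.mem_bhSet_iff_exists_pathHeight_le hs).1 hb
  refine (D'.mem_bhSet_iff_exists_pathHeight_le hs').2 ⟨j + 1, by omega, ?_⟩
  rw [hheight hsn, hheight (by omega)]
  omega
end
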